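/- For every finite simple graph G on vertex set V and every subset A ⊆ V, box(G) ≤ box(G[V ∖ A]) + |A|, where G[V ∖ A] is the induced subgraph of G on V ∖ A. -/

import Mathlib

/-- A finite simple graph `H` is an interval graph if there is an assignment of
real intervals `[l v, r v]` (with `l v ≤ r v`) to the vertices such that distinct
vertices are adjacent iff their intervals intersect. -/
def IsIntervalGraph {V : Type*} (H : SimpleGraph V) : Prop :=
  ∃ l r : V → ℝ, (∀ v, l v ≤ r v) ∧
    ∀ u v : V, u ≠ v →
      (H.Adj u v ↔ (Set.Icc (l u) (r u) ∩ Set.Icc (l v) (r v)).Nonempty)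

/-- The boxicity of `G` : the least `k` such that `G` is the edge-intersection of
`k` interval graphs on the same vertex set. -/
noncomputable def boxicity {V : Type*} (G : SimpleGraph V) : ℕ :=
  sInf {k | ∃ I : Fin k → SimpleGraph V,
    (∀ i, IsIntervalGraph (I i)) ∧ ∀ u v : V, G.Adj u v ↔ ∀ i, (I i).Adj u v}

/-- Intersecting families of interval graphs over an arbitrary index type. -/
def IsBoxRepresentation {V ι : Type*} (G : SimpleGraph V) (I : ι → SimpleGraph V) : Prop :=
  (∀ i, IsIntervalGraph (I i)) ∧ ∀ u v : V, G.Adj u v ↔ ∀ i, (I i).Adj u v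

/-- The graph in which the only non-edges are the non-edges of `G` at `a`. -/
def starSupergraph {V : Type*} (G : SimpleGraph V) (a : V) : SimpleGraph V where
  Adj u v := u ≠ v ∧ (u = a → G.Adj u v) ∧ (v = a → G.Adj u v)
  symm := ⟨fun _ _ h => ⟨h.1.symm, fun e => (h.2.2 e).symm, fun e => (h.2.1 e).symm⟩⟩
  loopless := ⟨fun _ h => h.1 rfl⟩

/-- The extension of a graph on `Aᶜ` by making all vertices of `A` universal. -/
def universalExtension {V : Type*} {A : Set V} (H : SimpleGraph (Aᶜ : Set V)) :
    SimpleGraph V where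
  Adj u v := u ≠ v ∧ ∀ (hu : u ∈ Aᶜ) (hv : v ∈ Aᶜ), H.Adj ⟨u, hu⟩ ⟨v, hv⟩
  symm := ⟨fun _ _ h => ⟨h.1.symm, fun hu hv => (h.2 hv hu).symm⟩⟩
  loopless := ⟨fun _ h => h.1 rfl⟩

theorem isIntervalGraph_starSupergraph {V : Type*} (G : SimpleGraph V) (a : V) :
    IsIntervalGraph (starSupergraph G a) := by
  classical
  refine ⟨fun v => if v = a ∨ G.Adj a v then 0 else 1, fun v => if v = a then 0 else 1,
    fun v => ?_, fun u v huv => ?_⟩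
  · by_cases h : v = a <;> by_cases h' : G.Adj a v <;> simp [h, h']
  · rw [Set.Icc_inter_Icc, Set.nonempty_Icc]
    by_cases hu : u = a
    · subst hu
      by_cases h : G.Adj u v <;> simp [starSupergraph, huv, huv.symm, h]
    · by_cases hv : v = a
      · subst hv
        by_cases h : G.Adj v u <;> simp [starSupergraph, huv, h, G.adj_comm u v]
      · by_cases h : G.Adj a u <;> by_cases h' : G.Adj a v <;>
          simp [starSupergraph, huv, hu, hv, h, h']

theorem IsIntervalGraph.universalExtension {V : Type*} [Finite V] {A : Set V}
    {H : SimpleGraph (Aᶜ : Set V)} (hH : IsIntervalGraph H) :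
    IsIntervalGraph (universalExtension H) := by
  classical
  obtain ⟨l, r, hlr, hadj⟩ := hH
  obtain ⟨m, hm⟩ := (Set.finite_range l).bddBelow
  obtain ⟨M, hM⟩ := (Set.finite_range r).bddAbove
  have hm' : ∀ v, m ≤ l v := fun v => hm ⟨v, rfl⟩
  have hM' : ∀ v, r v ≤ max m M := fun v => (hM ⟨v, rfl⟩).trans (le_max_right _ _)
  have hmM : m ≤ max m M := le_max_left _ _
  refine ⟨fun v => if h : v ∈ Aᶜ then l ⟨v, h⟩ else m,
    fun v => if h : v ∈ Aᶜ then r ⟨v, h⟩ else max m M, fun v => ?_, fun u v huv => ?_⟩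
  · by_cases h : v ∈ Aᶜ
    · simpa only [dif_pos h] using hlr _
    · simpa only [dif_neg h] using hmM
  · rw [Set.Icc_inter_Icc, Set.nonempty_Icc, sup_le_iff, le_inf_iff, le_inf_iff]
    by_cases hu : u ∈ Aᶜ <;> by_cases hv : v ∈ Aᶜ <;>
      simp only [_root_.universalExtension, hu, hv, dif_pos, dif_neg, not_false_eq_true,
        forall_true_left, IsEmpty.forall_iff, implies_true, and_true, huv, ne_eq, true_and,
        true_iff]
    · rw [hadj _ _ (by simpa using huv), Set.Icc_inter_Icc, Set.nonempty_Icc, sup_le_iff,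
        le_inf_iff, le_inf_iff]
    · exact ⟨⟨hlr _, (hlr _).trans (hM' _)⟩, (hm' _).trans (hlr _), hmM⟩
    · exact ⟨⟨hmM, (hm' _).trans (hlr _)⟩, (hlr _).trans (hM' _), hlr _⟩
    · exact ⟨⟨hmM, hmM⟩, hmM, hmM⟩

theorem IsBoxRepresentation.extend {V ι : Type*} [Finite V] {G : SimpleGraph V} {A : Set V}
    {I : ι → SimpleGraph (Aᶜ : Set V)} (hI : IsBoxRepresentation (G.induce (Aᶜ : Set V)) I) :
    IsBoxRepresentation G
      (Sum.elim (fun i => universalExtension (I i)) fun a : A => starSupergraph G a) := by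
  refine ⟨?_, fun u v => ⟨fun h => ?_, fun h => ?_⟩⟩
  · rintro (i | a)
    · exact (hI.1 i).universalExtension
    · exact isIntervalGraph_starSupergraph G a
  · rintro (i | a)
    · exact ⟨h.ne, fun hu hv => (hI.2 ⟨u, hu⟩ ⟨v, hv⟩).1 h i⟩
    · exact ⟨h.ne, fun _ => h, fun _ => h⟩
  · by_cases hu : u ∈ A
    · exact (h (.inr ⟨u, hu⟩)).2.1 rfl
    by_cases hv : v ∈ A
    · exact (h (.inr ⟨v, hv⟩)).2.2 rfl
    exact (hI.2 ⟨u, hu⟩ ⟨v, hv⟩).2 fun i => (h (.inl i)).2 hu hv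

theorem IsBoxRepresentation.reindex {V ι κ : Type*} {G : SimpleGraph V} {I : ι → SimpleGraph V}
    (hI : IsBoxRepresentation G I) (e : κ ≃ ι) : IsBoxRepresentation G (I ∘ e) :=
  ⟨fun _ => hI.1 _, fun u v => (hI.2 u v).trans e.forall_congr_right.symm⟩

theorem IsBoxRepresentation.boxicity_le {V ι : Type*} [Finite ι] {G : SimpleGraph V}
    {I : ι → SimpleGraph V} (hI : IsBoxRepresentation G I) : boxicity G ≤ Nat.card ι :=
  Nat.sInf_le ⟨_, hI.reindex (Finite.equivFin ι).symm⟩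

theorem exists_isBoxRepresentation_boxicity {V : Type*} [Finite V] (G : SimpleGraph V) :
    ∃ I : Fin (boxicity G) → SimpleGraph V, IsBoxRepresentation G I := by
  have h : IsBoxRepresentation (G.induce ((Set.univ : Set V)ᶜ : Set V)) (Fin.elim0 (α := _)) :=
    ⟨fun i => i.elim0, fun u => (u.2 trivial).elim⟩
  exact Nat.sInf_mem (s := {k | ∃ I : Fin k → SimpleGraph V, IsBoxRepresentation G I})
    ⟨_, _, h.extend.reindex (Finite.equivFin _).symm⟩

/-- For every finite simple graph `G` and every `A ⊆ V`,
`box(G) ≤ box(G[V \ A]) + |A|`. -/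
theorem boxicity_le_boxicity_induce_compl_add_card
    {V : Type*} [Fintype V] (G : SimpleGraph V) (A : Set V) :
    boxicity G ≤ boxicity (G.induce (Aᶜ : Set V)) + A.ncard := by
  obtain ⟨I, hI⟩ := exists_isBoxRepresentation_boxicity (G.induce (Aᶜ : Set V))
  simpa [Nat.card_sum] using hI.extend.boxicity_le
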